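/- Let (Ω, 𝒜) be a measurable space, μ a probability measure on Ω, d a natural number, and X : Ω → (Fin d → ℝ) a measurable function that is bounded, i.e. there exists C ∈ ℝ such that |X ω j| ≤ C for all ω and j. Then there exist points ω : Fin (d+1) → Ω and coefficients α : Fin (d+1) → ℝ with 0 ≤ α i for all i and ∑ i, α i = 1, such that ∫ X ∂μ = ∑ i, α i • X (ω i). -/

import Mathlib

open MeasureTheory

theorem exists_support_aux {E : Type*} [NormedAddCommGroup E] [NormedSpace ℝ E]
    [FiniteDimensional ℝ E] {s : Set E} (hs : Convex ℝ s) (hne : s.Nonempty) {x : E}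
    (hx : x ∉ s) :
    ∃ φ : E →L[ℝ] ℝ, φ ≠ 0 ∧ ((∀ y ∈ s, φ y ≤ φ x) ∨ ∃ c, ∀ y ∈ s, φ y = c) := by
  by_cases hi : (interior s).Nonempty
  · obtain ⟨φ, hφ⟩ := geometric_hahn_banach_open_point hs.interior isOpen_interior
      (fun h => hx (interior_subset h))
    refine ⟨φ, ?_, Or.inl ?_⟩
    · rintro rfl
      obtain ⟨y, hy⟩ := hi
      simpa using hφ y hy
    · intro y hy
      have h1 : y ∈ closure (interior s) := by
        rw [hs.closure_interior_eq_closure_of_nonempty_interior hi]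
        exact subset_closure hy
      have h2 : closure (interior s) ⊆ {z | φ z ≤ φ x} :=
        closure_minimal (fun z hz => (hφ z hz).le)
          (isClosed_le φ.continuous continuous_const)
      exact h2 h1
  · rw [hs.interior_nonempty_iff_affineSpan_eq_top] at hi
    have hd : (affineSpan ℝ s).direction ≠ ⊤ := by
      intro h
      exact hi ((AffineSubspace.direction_eq_top_iff_of_nonempty
        ((affineSpan_nonempty ℝ).2 hne)).1 h)
    obtain ⟨f, hf, hk⟩ := Submodule.exists_le_ker_of_lt_top _ (lt_top_iff_ne_top.2 hd)
    obtain ⟨y0, hy0⟩ := hne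
    refine ⟨LinearMap.toContinuousLinearMap f, ?_, Or.inr ⟨f y0, ?_⟩⟩
    · intro h
      apply hf
      ext v
      simpa using DFunLike.congr_fun h v
    · intro y hy
      have h1 : y -ᵥ y0 ∈ (affineSpan ℝ s).direction :=
        AffineSubspace.vsub_mem_direction (mem_affineSpan ℝ hy) (mem_affineSpan ℝ hy0)
      have h2 := hk h1
      rw [LinearMap.mem_ker, vsub_eq_sub, map_sub, sub_eq_zero] at h2
      simpa using h2

theorem integral_mem_aux {Ω : Type*} [MeasurableSpace Ω] (μ : Measure Ω)
    [IsProbabilityMeasure μ] (n : ℕ) : ∀ (E : Type*) [NormedAddCommGroup E] [NormedSpace ℝ E]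
    [FiniteDimensional ℝ E], Module.finrank ℝ E = n → ∀ (s : Set E), Convex ℝ s →
    ∀ f : Ω → E, Integrable f μ → (∀ᵐ ω ∂μ, f ω ∈ s) → (∫ ω, f ω ∂μ) ∈ s := by
  induction n using Nat.strong_induction_on with
  | _ n ih =>
  intro E _ _ _ hn s hs f hf hfs
  by_contra hx
  have hne : s.Nonempty := by
    obtain ⟨ω, hω⟩ := hfs.exists
    exact ⟨_, hω⟩
  obtain ⟨φ, hφ0, hφ⟩ := exists_support_aux hs hne hx
  set x := ∫ ω, f ω ∂μ with hxdef
  have hφi : ∫ ω, φ (f ω) ∂μ = φ x := φ.integral_comp_comm hf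
  have hφf : Integrable (fun ω => φ (f ω)) μ := φ.integrable_comp hf
  have hae : ∀ᵐ ω ∂μ, φ (f ω) = φ x := by
    rcases hφ with h | ⟨c, h⟩
    · have h0 : ∫ ω, (φ x - φ (f ω)) ∂μ = 0 := by
        rw [integral_sub (integrable_const _) hφf, hφi]
        simp
      have h1 := (integral_eq_zero_iff_of_nonneg_ae
        (hfs.mono fun ω hω => sub_nonneg.2 (h _ hω))
        ((integrable_const _).sub hφf)).1 h0
      filter_upwards [h1] with ω hω
      have : φ x - φ (f ω) = 0 := hω
      linarith
    · have h1 : ∀ᵐ ω ∂μ, φ (f ω) = c := hfs.mono fun ω hω => h _ hω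
      have h2 : φ x = c := by
        rw [← hφi, integral_congr_ae h1]
        simp
      rw [h2]
      exact h1
  let K : Submodule ℝ E := LinearMap.ker (φ : E →ₗ[ℝ] ℝ)
  have hK : Module.finrank ℝ K < n := by
    rw [← hn]
    apply Submodule.finrank_lt
    intro h
    apply hφ0
    ext v
    have : v ∈ K := by rw [show K = ⊤ from h]; trivial
    exact this
  obtain ⟨P, hP⟩ := Submodule.ClosedComplemented.of_finiteDimensional K
  have hg : Integrable (fun ω => P (f ω - x)) μ :=
    P.integrable_comp (hf.sub (integrable_const x))
  have hgi : ∫ ω, P (f ω - x) ∂μ = 0 := by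
    have hsub : Integrable (fun ω => f ω - x) μ := hf.sub (integrable_const x)
    rw [P.integral_comp_comm hsub, integral_sub hf (integrable_const x)]
    simp [← hxdef]
  have hs' : Convex ℝ {k : K | (k : E) + x ∈ s} := by
    intro a ha b hb t u ht hu htu
    have := hs ha hb ht hu htu
    have e : t • ((a : E) + x) + u • ((b : E) + x) = ((t • a + u • b : K) : E) + x := by
      have : x = (t + u) • x := by rw [htu, one_smul]
      conv_rhs => rw [this]
      push_cast
      module
    rw [e] at this
    exact this
  have hmem := ih _ hK K rfl _ hs' _ hg (by
    filter_upwards [hae, hfs] with ω h1 h2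
    have h3 : f ω - x ∈ K := by
      change φ (f ω - x) = 0
      rw [map_sub, h1, sub_self]
    have h4 := hP ⟨f ω - x, h3⟩
    simp only at h4
    rw [h4]
    simpa using h2)
  rw [hgi] at hmem
  apply hx
  simpa using hmem

theorem stmt8 {Ω : Type*} [MeasurableSpace Ω] (μ : Measure Ω) [IsProbabilityMeasure μ]
    (d : ℕ) (X : Ω → (Fin d → ℝ)) (hX : Measurable X)
    (hbd : ∃ C : ℝ, ∀ (ω : Ω) (j : Fin d), |X ω j| ≤ C) :
    ∃ p : Fin (d + 1) → Ω, ∃ α : Fin (d + 1) → ℝ,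
      (∀ i, 0 ≤ α i) ∧ (∑ i, α i = 1) ∧
      (∫ ω, X ω ∂μ) = ∑ i, α i • X (p i) := by
  obtain ⟨C, hC⟩ := hbd
  obtain ⟨ω0⟩ : Nonempty Ω := nonempty_of_isProbabilityMeasure μ
  have hint : Integrable X μ := by
    apply Integrable.of_bound hX.aestronglyMeasurable (max C 0)
    refine Filter.Eventually.of_forall fun ω => ?_
    rw [pi_norm_le_iff_of_nonneg (le_max_right _ _)]
    exact fun j => (hC ω j).trans (le_max_left _ _)
  have hmem := integral_mem_aux μ _ _ rfl (convexHull ℝ (Set.range X)) (convex_convexHull ℝ _)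
    X hint (Filter.Eventually.of_forall fun ω => subset_convexHull ℝ _ ⟨ω, rfl⟩)
  obtain ⟨ι, _, z, w, hz, hai, hw, hw1, hsum⟩ := eq_pos_convex_span_of_mem_convexHull hmem
  have hcard : Fintype.card ι ≤ Fintype.card (Fin (d + 1)) := by
    have := hai.card_le_finrank_succ
    have h2 := Submodule.finrank_le (vectorSpan ℝ (Set.range z))
    simp at h2 ⊢
    omega
  obtain ⟨e⟩ := Function.Embedding.nonempty_of_card_le hcard
  choose q hq using fun i => hz ⟨i, rfl⟩
  refine ⟨Function.extend e q (fun _ => ω0), Function.extend e w 0, ?_, ?_, ?_⟩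
  · intro i
    by_cases h : ∃ a, e a = i
    · obtain ⟨a, rfl⟩ := h
      rw [e.injective.extend_apply]
      exact (hw a).le
    · rw [Function.extend_apply' _ _ _ h]
      simp
  · rw [← hw1]
    symm
    apply Fintype.sum_of_injective e e.injective
    · intro i h
      rw [Function.extend_apply' _ _ _ h]
      simp
    · intro a
      rw [e.injective.extend_apply]
  · rw [← hsum]
    apply Fintype.sum_of_injective e e.injective
    · intro i h
      rw [Function.extend_apply' w _ _ h]
      simp
    · intro a
      rw [e.injective.extend_apply, e.injective.extend_apply, hq]
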